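/- There exists a constant C depending only on the matrix A such that the following holds. Let T be a separated family of caps (centers pairwise at distance ≥ √(λδ) on {Q = λ²}) and let s ≥ 1 be an integer. Then the number of caps θ in the family such that Λ_θ has rank 2 and 2^s ≤ N_θ < 2^{s+1} is at most C (2^{−s} λδ)³. -/

import Mathlib

open Matrix

/-- The quadratic form `Q(x) = xᵀ A x`. -/
noncomputable def Qform (A : Matrix (Fin 3) (Fin 3) ℝ) (x : Fin 3 → ℝ) : ℝ :=
  ∑ i, ∑ j, A i j * x i * x j

/-- The Euclidean norm on `ℝ³`. -/
noncomputable def enorm3 (x : Fin 3 → ℝ) : ℝ := Real.sqrt (∑ i, x i ^ 2)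

/-- Coercion of an integer vector to a real vector. -/
def intCast3 (k : Fin 3 → ℤ) : Fin 3 → ℝ := fun i => (k i : ℝ)

/-- The set of lattice points in the cap of the shell `S_{λ,δ}` centered at `x₀`. -/
def capLattice (A : Matrix (Fin 3) (Fin 3) ℝ) (lam δ : ℝ) (x₀ : Fin 3 → ℝ) :
    Set (Fin 3 → ℤ) :=
  {k | |Real.sqrt (Qform A (intCast3 k)) - lam| < δ ∧
       enorm3 (intCast3 k - x₀) < Real.sqrt (lam * δ)}

/-- `N_θ`, the number of lattice points in the cap centered at `x₀`. -/
noncomputable def Ncap (A : Matrix (Fin 3) (Fin 3) ℝ) (lam δ : ℝ) (x₀ : Fin 3 → ℝ) : ℕ :=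
  (capLattice A lam δ x₀).ncard

/-- `Λ_θ`, the subgroup of `ℤ³` generated by differences of lattice points of the cap. -/
def capSpan (A : Matrix (Fin 3) (Fin 3) ℝ) (lam δ : ℝ) (x₀ : Fin 3 → ℝ) :
    Submodule ℤ (Fin 3 → ℤ) :=
  Submodule.span ℤ
    {d | ∃ y ∈ capLattice A lam δ x₀, ∃ z ∈ capLattice A lam δ x₀, d = y - z}

/-- A subset of `ℝ³` is an affine line. -/
def IsAffineLine (L : Set (Fin 3 → ℝ)) : Prop :=
  ∃ pt d : Fin 3 → ℝ, d ≠ 0 ∧ L = {x | ∃ t : ℝ, x = pt + t • d}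

theorem exists_primitive_int_vector {w : Fin 3 → ℤ} (hw : w ≠ 0) :
    ∃ (g : ℤ) (h e : Fin 3 → ℤ), w = g • h ∧ e ⬝ᵥ h = 1 := by
  obtain ⟨g, hg⟩ := (IsPrincipalIdealRing.principal (Ideal.span (Set.range w))).principal
  have hmem : ∀ i, ∃ k, k * g = w i := fun i => by
    have : w i ∈ Ideal.span (Set.range w) := Ideal.subset_span ⟨i, rfl⟩
    rw [hg] at this
    exact Submodule.mem_span_singleton.1 this
  choose h hh using hmem
  have hg' : g ∈ Ideal.span (Set.range w) := by
    rw [hg]; exact Submodule.mem_span_singleton_self g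
  obtain ⟨e, he⟩ := (Ideal.mem_span_range_iff_exists_fun).1 hg'
  have hg0 : g ≠ 0 := by
    rintro rfl
    exact hw (funext fun i => by simp [← hh i])
  refine ⟨g, h, e, funext fun i => by simp [← hh i, mul_comm], ?_⟩
  apply mul_right_cancel₀ hg0
  rw [one_mul]
  conv_rhs => rw [← he]
  simp only [dotProduct, Fin.sum_univ_three, ← hh]
  ring

theorem eq_smul_of_cross_eq_zero {h e w : Fin 3 → ℤ} (he : e ⬝ᵥ h = 1) (hw : h ⨯₃ w = 0) :
    w = (e ⬝ᵥ w) • h := by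
  have h0 := congrFun hw 0
  have h1 := congrFun hw 1
  have h2 := congrFun hw 2
  simp [cross_apply] at h0 h1 h2
  simp only [dotProduct, Fin.sum_univ_three] at he
  funext i
  simp only [dotProduct, Fin.sum_univ_three, Pi.smul_apply, smul_eq_mul]
  fin_cases i <;> simp
  · linear_combination (-w 0) * he - e 1 * h2 + e 2 * h1
  · linear_combination (-w 1) * he + e 0 * h2 - e 2 * h0
  · linear_combination (-w 2) * he - e 0 * h1 + e 1 * h0

theorem exists_card_sub_one_le_sub {α : Type*} [DecidableEq α] {T : Finset α} (hT : T.Nonempty)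
    {f : α → ℤ} (hf : Set.InjOn f T) :
    ∃ p ∈ T, ∃ q ∈ T, (T.card : ℤ) - 1 ≤ f q - f p := by
  obtain ⟨p, hp, hpmin⟩ := T.exists_min_image f hT
  obtain ⟨q, hq, hqmax⟩ := T.exists_max_image f hT
  refine ⟨p, hp, q, hq, ?_⟩
  have hsub : T.image f ⊆ Finset.Icc (f p) (f q) := by
    intro y hy
    obtain ⟨x, hx, rfl⟩ := Finset.mem_image.1 hy
    exact Finset.mem_Icc.2 ⟨hpmin x hx, hqmax x hx⟩
  have hcard := Finset.card_le_card hsub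
  rw [Finset.card_image_of_injOn hf, Int.card_Icc] at hcard
  have := hpmin q hq
  lia

/-- Among coplanar, non-collinear lattice points there are three spanning a triangle whose
(integral) normal vector is a multiple, by a factor comparable to the number of points, of a
nonzero lattice vector. -/
theorem exists_cross_eq_large_smul {S : Finset (Fin 3 → ℤ)} (hS : 2 ≤ S.card)
    (hplane : ∀ p ∈ S, ∀ q ∈ S, ∀ r ∈ S, ∀ t ∈ S, (q - p) ⬝ᵥ ((r - p) ⨯₃ (t - p)) = 0)
    (hline : ∀ p d : Fin 3 → ℤ, ∃ x ∈ S, ∀ k : ℤ, x - p ≠ k • d) :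
    ∃ p ∈ S, ∃ q ∈ S, ∃ u ∈ S, ∃ (c : ℤ) (h : Fin 3 → ℤ), h ≠ 0 ∧
      (q - p) ⨯₃ (u - p) = c • h ∧ (S.card : ℤ) ≤ 8 * |c| := by
  classical
  obtain ⟨p₀, hp₀, q₀, hq₀, hpq⟩ := Finset.one_lt_card.1 hS
  obtain ⟨g, d, ed, hw, hed⟩ := exists_primitive_int_vector (w := q₀ - p₀)
    (fun h => hpq (sub_eq_zero.1 h).symm)
  have hg : g ≠ 0 := by
    rintro rfl
    rw [zero_smul] at hw
    exact hpq (sub_eq_zero.1 hw).symm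
  obtain ⟨u₀, hu₀, hu₀k⟩ := hline p₀ d
  have hn₀ : d ⨯₃ (u₀ - p₀) ≠ 0 := fun h0 => hu₀k _ (eq_smul_of_cross_eq_zero hed h0)
  obtain ⟨g', h, eh, hn, heh⟩ := exists_primitive_int_vector hn₀
  have hg' : g' ≠ 0 := by
    rintro rfl
    rw [zero_smul] at hn
    exact hn₀ hn
  have hh : h ≠ 0 := by
    rintro rfl
    simp at heh
  set φ : (Fin 3 → ℤ) → ℤ := fun x => eh ⬝ᵥ (d ⨯₃ (x - p₀)) with hφ
  have hcross : ∀ x ∈ S, d ⨯₃ (x - p₀) = φ x • h := by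
    intro x hx
    apply eq_smul_of_cross_eq_zero heh
    have hdet : d ⬝ᵥ ((u₀ - p₀) ⨯₃ (x - p₀)) = 0 := by
      have := hplane p₀ hp₀ q₀ hq₀ u₀ hu₀ x hx
      rw [hw, smul_dotProduct, smul_eq_mul] at this
      exact (mul_eq_zero.1 this).resolve_left hg
    have hz : g' • (h ⨯₃ (d ⨯₃ (x - p₀))) = 0 := by
      rw [← LinearMap.smul_apply, ← map_smul, ← hn]
      generalize u₀ - p₀ = a at hdet
      generalize x - p₀ = b at hdet
      simp only [dotProduct, Fin.sum_univ_three, cross_apply, cons_val_zero, cons_val_one,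
        cons_val] at hdet
      ext i
      fin_cases i <;> simp [cross_apply]
      · linear_combination (d 0) * hdet
      · linear_combination (d 1) * hdet
      · linear_combination (d 2) * hdet
    exact (smul_eq_zero.1 hz).resolve_left hg'
  have hφp : φ p₀ = 0 := by simp [hφ]
  have hφq : φ q₀ = 0 := by
    change eh ⬝ᵥ (d ⨯₃ (q₀ - p₀)) = 0
    rw [hw, map_smul, cross_self, smul_zero, dotProduct_zero]
  have hφu : φ u₀ ≠ 0 := by
    intro h0
    exact hn₀ (by rw [hcross u₀ hu₀, h0, zero_smul])
  obtain ⟨v, hv, hvmax⟩ := (S.image φ).exists_max_image (fun b => (S.filter (φ · = b)).card)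
    ⟨φ p₀, Finset.mem_image_of_mem _ hp₀⟩
  set F := S.filter (φ · = v) with hF
  have hN : S.card ≤ F.card * (S.image φ).card := Finset.card_le_mul_card_image S F.card hvmax
  have hm : 2 ≤ F.card := by
    refine le_trans ?_ (hvmax (φ p₀) (Finset.mem_image_of_mem _ hp₀))
    exact Finset.one_lt_card.2 ⟨p₀, by simp [hp₀], q₀, by simp [hq₀, hφp, hφq], hpq⟩
  have hM : 2 ≤ (S.image φ).card :=
    Finset.one_lt_card.2 ⟨φ p₀, Finset.mem_image_of_mem _ hp₀, φ u₀,
      Finset.mem_image_of_mem _ hu₀, by rw [hφp]; exact hφu.symm⟩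
  have hdiff : ∀ x ∈ S, ∀ y ∈ S, d ⨯₃ (x - y) = (φ x - φ y) • h := by
    intro x hx y hy
    rw [sub_smul, ← hcross x hx, ← hcross y hy, ← map_sub, sub_sub_sub_cancel_right]
  have hfib : ∀ x ∈ F, ∀ y ∈ F, x - y = (ed ⬝ᵥ x - ed ⬝ᵥ y) • d := by
    intro x hx y hy
    rw [hF, Finset.mem_filter] at hx hy
    rw [← dotProduct_sub]
    exact eq_smul_of_cross_eq_zero hed
      (by rw [hdiff x hx.1 y hy.1, hx.2, hy.2, sub_self, zero_smul])
  obtain ⟨p, hp, q, hq, hpqm⟩ := exists_card_sub_one_le_sub (T := F) (f := fun x => ed ⬝ᵥ x)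
    (Finset.card_pos.1 (by omega)) (fun x hx y hy hxy => by
      have := hfib x hx y hy
      simp only at hxy
      rw [hxy, sub_self, zero_smul] at this
      exact sub_eq_zero.1 this)
  obtain ⟨y, hy, z, hz, hyz⟩ := exists_card_sub_one_le_sub (T := S.image φ) (f := id)
    ⟨v, hv⟩ Function.injective_id.injOn
  have hu : ∃ u ∈ S, ((S.image φ).card : ℤ) - 1 ≤ 2 * |φ u - v| := by
    obtain ⟨y', hy', rfl⟩ := Finset.mem_image.1 hy
    obtain ⟨z', hz', rfl⟩ := Finset.mem_image.1 hz
    simp only [id] at hyz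
    by_cases hc : ((S.image φ).card : ℤ) - 1 ≤ 2 * |φ y' - v|
    · exact ⟨y', hy', hc⟩
    · refine ⟨z', hz', ?_⟩
      have h1 := le_abs_self (φ z' - v)
      have h2 := neg_abs_le (φ y' - v)
      linarith
  obtain ⟨u, hu, huM⟩ := hu
  have hpF := (Finset.mem_filter.1 hp)
  have hqF := (Finset.mem_filter.1 hq)
  refine ⟨p, hpF.1, q, hqF.1, u, hu, (ed ⬝ᵥ q - ed ⬝ᵥ p) * (φ u - φ p), h, hh, ?_, ?_⟩
  · rw [hfib q hq p hp, map_smul, LinearMap.smul_apply, hdiff u hu p hpF.1, smul_smul]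
  · rw [hpF.2, abs_mul]
    have h1 : (S.card : ℤ) ≤ F.card * (S.image φ).card := by exact_mod_cast hN
    have h2 : (F.card : ℤ) ≤ 2 * |ed ⬝ᵥ q - ed ⬝ᵥ p| := by
      have := le_abs_self (ed ⬝ᵥ q - ed ⬝ᵥ p)
      have : (2 : ℤ) ≤ F.card := by exact_mod_cast hm
      linarith
    have h3 : ((S.image φ).card : ℤ) ≤ 4 * |φ u - v| := by
      have : (2 : ℤ) ≤ (S.image φ).card := by exact_mod_cast hM
      linarith
    calc (S.card : ℤ) ≤ F.card * (S.image φ).card := h1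
      _ ≤ (2 * |ed ⬝ᵥ q - ed ⬝ᵥ p|) * (4 * |φ u - v|) :=
        mul_le_mul h2 h3 (Int.natCast_nonneg _) (by positivity)
      _ = _ := by ring

theorem dotProduct_cross_eq_zero_of_finrank_eq_two {Λ : Submodule ℤ (Fin 3 → ℤ)}
    (h : Module.finrank ℤ Λ = 2) {a b c : Fin 3 → ℤ} (ha : a ∈ Λ) (hb : b ∈ Λ) (hc : c ∈ Λ) :
    a ⬝ᵥ (b ⨯₃ c) = 0 := by
  rw [triple_product_eq_det]
  by_contra hdet
  have hli := Matrix.linearIndependent_rows_of_det_ne_zero hdet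
  have hli' : LinearIndependent ℤ (![⟨a, ha⟩, ⟨b, hb⟩, ⟨c, hc⟩] : Fin 3 → Λ) := by
    apply LinearIndependent.of_comp Λ.subtype
    have hcomp : Λ.subtype ∘ (![⟨a, ha⟩, ⟨b, hb⟩, ⟨c, hc⟩] : Fin 3 → Λ) = ![a, b, c] := by
      funext i
      fin_cases i <;> rfl
    rw [hcomp]
    exact hli
  have := hli'.fintype_card_le_finrank
  simp [h] at this

theorem exists_sub_ne_smul_of_finrank_eq_two {S : Set (Fin 3 → ℤ)}
    (h : Module.finrank ℤ (Submodule.span ℤ {d | ∃ y ∈ S, ∃ z ∈ S, d = y - z}) = 2)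
    (p d : Fin 3 → ℤ) : ∃ x ∈ S, ∀ k : ℤ, x - p ≠ k • d := by
  by_contra! hcon
  have hle : Submodule.span ℤ {d | ∃ y ∈ S, ∃ z ∈ S, d = y - z} ≤ Submodule.span ℤ {d} := by
    rw [Submodule.span_le]
    rintro _ ⟨y, hy, z, hz, rfl⟩
    obtain ⟨k, hk⟩ := hcon y hy
    obtain ⟨l, hl⟩ := hcon z hz
    refine Submodule.mem_span_singleton.2 ⟨k - l, ?_⟩
    rw [sub_smul, ← hk, ← hl, sub_sub_sub_cancel_right]
  have h1 := Submodule.finrank_mono hle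
  have h2 := finrank_span_le_card (R := ℤ) ({d} : Set (Fin 3 → ℤ))
  simp at h2
  omega

theorem qform_eq_dotProduct (A : Matrix (Fin 3) (Fin 3) ℝ) (x : Fin 3 → ℝ) :
    Qform A x = x ⬝ᵥ A *ᵥ x := by
  simp only [Qform, dotProduct, mulVec, Finset.mul_sum]
  refine Finset.sum_congr rfl fun i _ => Finset.sum_congr rfl fun j _ => ?_
  ring

theorem dotProduct_mulVec_comm_of_isSymm {A : Matrix (Fin 3) (Fin 3) ℝ} (hA : A.IsSymm)
    (x y : Fin 3 → ℝ) : x ⬝ᵥ A *ᵥ y = y ⬝ᵥ A *ᵥ x := by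
  rw [dotProduct_mulVec, ← mulVec_transpose, hA.eq, dotProduct_comm]

theorem qform_add {A : Matrix (Fin 3) (Fin 3) ℝ} (hA : A.IsSymm) (x y : Fin 3 → ℝ) :
    Qform A (x + y) = Qform A x + 2 * (y ⬝ᵥ A *ᵥ x) + Qform A y := by
  simp only [qform_eq_dotProduct, mulVec_add, dotProduct_add, add_dotProduct]
  rw [dotProduct_mulVec_comm_of_isSymm hA x y]
  ring

theorem qform_sub_qform {A : Matrix (Fin 3) (Fin 3) ℝ} (hA : A.IsSymm) (x y : Fin 3 → ℝ) :
    Qform A x - Qform A y = (x - y) ⬝ᵥ A *ᵥ (x + y) := by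
  simp only [qform_eq_dotProduct, mulVec_add, dotProduct_add, sub_dotProduct]
  rw [dotProduct_mulVec_comm_of_isSymm hA x y]
  ring

theorem qform_smul (A : Matrix (Fin 3) (Fin 3) ℝ) (t : ℝ) (x : Fin 3 → ℝ) :
    Qform A (t • x) = t ^ 2 * Qform A x := by
  simp only [qform_eq_dotProduct, mulVec_smul, dotProduct_smul, smul_dotProduct, smul_eq_mul]
  ring

theorem qform_pos {A : Matrix (Fin 3) (Fin 3) ℝ} (hA : A.PosDef) {x : Fin 3 → ℝ} (hx : x ≠ 0) :
    0 < Qform A x := by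
  rw [qform_eq_dotProduct]
  simpa using hA.dotProduct_mulVec_pos hx

theorem qform_nonneg {A : Matrix (Fin 3) (Fin 3) ℝ} (hA : A.PosDef) (x : Fin 3 → ℝ) :
    0 ≤ Qform A x := by
  rcases eq_or_ne x 0 with rfl | hx
  · simp [Qform]
  · exact (qform_pos hA hx).le

theorem abs_dotProduct_le (x y : Fin 3 → ℝ) : |x ⬝ᵥ y| ≤ 3 * ‖x‖ * ‖y‖ := by
  have h : ∀ i, |x i * y i| ≤ ‖x‖ * ‖y‖ := fun i => by
    rw [abs_mul]
    exact mul_le_mul (norm_le_pi_norm x i) (norm_le_pi_norm y i) (abs_nonneg _) (norm_nonneg _)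
  calc |x ⬝ᵥ y| ≤ ∑ i, |x i * y i| := Finset.abs_sum_le_sum_abs _ _
    _ ≤ ∑ _i : Fin 3, ‖x‖ * ‖y‖ := Finset.sum_le_sum fun i _ => h i
    _ = 3 * ‖x‖ * ‖y‖ := by simp; ring

theorem abs_apply_le_enorm3 (x : Fin 3 → ℝ) (i : Fin 3) : |x i| ≤ enorm3 x := by
  rw [← Real.sqrt_sq_eq_abs]
  exact Real.sqrt_le_sqrt
    (Finset.single_le_sum (f := fun i => x i ^ 2) (fun j _ => sq_nonneg _) (Finset.mem_univ i))

theorem norm_le_enorm3 (x : Fin 3 → ℝ) : ‖x‖ ≤ enorm3 x :=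
  (pi_norm_le_iff_of_nonneg (Real.sqrt_nonneg _)).2 (abs_apply_le_enorm3 x)

theorem enorm3_le_two_mul_norm (x : Fin 3 → ℝ) : enorm3 x ≤ 2 * ‖x‖ := by
  refine Real.sqrt_le_iff.2 ⟨by positivity, ?_⟩
  have h : ∀ i, x i ^ 2 ≤ ‖x‖ ^ 2 := fun i => by
    rw [← sq_abs]
    exact pow_le_pow_left₀ (abs_nonneg _) (norm_le_pi_norm x i) 2
  rw [Fin.sum_univ_three]
  nlinarith [h 0, h 1, h 2, sq_nonneg ‖x‖]

theorem exists_norm_mulVec_le (A : Matrix (Fin 3) (Fin 3) ℝ) :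
    ∃ M : ℝ, ∀ z, ‖A *ᵥ z‖ ≤ M * ‖z‖ :=
  ⟨_, fun z => A.mulVecLin.toContinuousLinearMap.le_opNorm z⟩

theorem exists_norm_le_mul_sqrt_qform {A : Matrix (Fin 3) (Fin 3) ℝ} (hA : A.PosDef) :
    ∃ M : ℝ, ∀ z, ‖z‖ ≤ M * √(Qform A z) := by
  have hcont : Continuous (Qform A) := by
    unfold Qform
    fun_prop
  have hne : (Metric.sphere (0 : Fin 3 → ℝ) 1).Nonempty := NormedSpace.sphere_nonempty.2 zero_le_one
  obtain ⟨z₀, hz₀, hmin⟩ :=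
    (isCompact_sphere (0 : Fin 3 → ℝ) 1).exists_isMinOn hne hcont.continuousOn
  have hpos : 0 < Qform A z₀ := qform_pos hA (ne_zero_of_mem_unit_sphere ⟨z₀, hz₀⟩)
  have hs : 0 < √(Qform A z₀) := Real.sqrt_pos.2 hpos
  refine ⟨(√(Qform A z₀))⁻¹, fun z => ?_⟩
  rcases eq_or_ne z 0 with rfl | hz
  · simp [Qform]
  have hzn : 0 < ‖z‖ := norm_pos_iff.2 hz
  have hmem : ‖z‖⁻¹ • z ∈ Metric.sphere (0 : Fin 3 → ℝ) 1 := by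
    simp [norm_smul, hzn.ne']
  have h := hmin hmem
  simp only [Set.mem_ofPred_eq, qform_smul] at h
  rw [inv_mul_eq_div, le_div_iff₀ hs]
  apply Real.le_sqrt_of_sq_le
  rw [mul_pow, Real.sq_sqrt hpos.le]
  calc ‖z‖ ^ 2 * Qform A z₀ ≤ ‖z‖ ^ 2 * (‖z‖⁻¹ ^ 2 * Qform A z) := by gcongr
    _ = Qform A z := by field_simp

theorem abs_sub_mul_le_norm_cross (h u : Fin 3 → ℝ) (i j : Fin 3) :
    |u j * h i - u i * h j| ≤ ‖h ⨯₃ u‖ := by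
  have h0 := norm_le_pi_norm (h ⨯₃ u) 0
  have h1 := norm_le_pi_norm (h ⨯₃ u) 1
  have h2 := norm_le_pi_norm (h ⨯₃ u) 2
  simp only [cross_apply, Real.norm_eq_abs, cons_val_zero, cons_val_one, cons_val] at h0 h1 h2
  rw [← cross_apply] at h0 h1 h2
  rw [abs_le] at h0 h1 h2 ⊢
  fin_cases i <;> fin_cases j <;> simp <;> constructor <;> linarith

theorem exists_apply_eq_norm (x : Fin 3 → ℝ) : ∃ i, |x i| = ‖x‖ := by
  obtain ⟨i, -, hi⟩ := (Finset.univ : Finset (Fin 3)).exists_max_image (fun i => |x i|)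
    Finset.univ_nonempty
  exact ⟨i, le_antisymm (norm_le_pi_norm x i)
    ((pi_norm_le_iff_of_nonneg (abs_nonneg _)).2 fun j => hi j (Finset.mem_univ j))⟩

/-- A point of the ellipsoid whose normal direction is close to the direction of `h` is close to
one of the two points of the ellipsoid whose normal is parallel to `h`. -/
theorem exists_norm_sub_le_of_norm_cross_le {A : Matrix (Fin 3) (Fin 3) ℝ} (hA : A.IsSymm)
    (hApd : A.PosDef) {M : ℝ} (hM : 0 ≤ M) (hM₁ : ∀ z, ‖A *ᵥ z‖ ≤ M * ‖z‖)
    (hM₂ : ∀ z, ‖A⁻¹ *ᵥ z‖ ≤ M * ‖z‖) (hM₃ : ∀ z, ‖z‖ ≤ M * √(Qform A z))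
    {h : Fin 3 → ℝ} (hh : h ≠ 0) {lam : ℝ} (hlam : 0 < lam) :
    ∃ p : Fin 3 → ℝ, ∀ (x : Fin 3 → ℝ) (ρ : ℝ), Qform A x = lam ^ 2 →
      ‖h ⨯₃ (A *ᵥ x)‖ ≤ ρ * ‖h‖ →
      ‖x - p‖ ≤ (M + 3 * M ^ 4) * ρ ∨ ‖x - -p‖ ≤ (M + 3 * M ^ 4) * ρ := by
  have hdet : IsUnit A.det := hApd.det_pos.ne'.isUnit
  set a := A⁻¹ *ᵥ h with ha
  have hAa : A *ᵥ a = h := by rw [ha, mulVec_mulVec, mul_nonsing_inv _ hdet, one_mulVec]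
  have ha0 : a ≠ 0 := by
    intro h0
    rw [h0, mulVec_zero] at hAa
    exact hh hAa.symm
  set q := √(Qform A a) with hq
  have hqpos : 0 < q := Real.sqrt_pos.2 (qform_pos hApd ha0)
  have hnorm : 0 < ‖h‖ := norm_pos_iff.2 hh
  refine ⟨(lam / q) • a, fun x ρ hx hc => ?_⟩
  obtain ⟨i, hi⟩ := exists_apply_eq_norm h
  have hi0 : h i ≠ 0 := by
    intro h0
    rw [h0, abs_zero] at hi
    exact hnorm.ne hi
  set t := (A *ᵥ x) i / h i with ht
  set e := A *ᵥ x - t • h with he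
  have hρ : 0 ≤ ρ := nonneg_of_mul_nonneg_left ((norm_nonneg _).trans hc) hnorm
  have hen : ‖e‖ ≤ ρ := by
    refine (pi_norm_le_iff_of_nonneg hρ).2 fun j => ?_
    have hej : e j * h i = (A *ᵥ x) j * h i - (A *ᵥ x) i * h j := by
      simp only [he, ht, Pi.sub_apply, Pi.smul_apply, smul_eq_mul]
      field_simp
    have := (abs_sub_mul_le_norm_cross h (A *ᵥ x) i j).trans hc
    rw [← hej, abs_mul, hi] at this
    exact le_of_mul_le_mul_right this hnorm
  set f := A⁻¹ *ᵥ e with hf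
  have hfn : ‖f‖ ≤ M * ρ := (hM₂ e).trans (by gcongr)
  have hxf : x = t • a + f := by
    rw [hf, he, mulVec_sub, mulVec_smul, mulVec_mulVec, nonsing_inv_mul _ hdet, one_mulVec,
      ← ha, add_sub_cancel]
  have hsx : √(Qform A x) = lam := by rw [hx, Real.sqrt_sq hlam.le]
  have hsa : √(Qform A (t • a)) = |t| * q := by
    rw [qform_smul, Real.sqrt_mul (sq_nonneg t), Real.sqrt_sq_eq_abs]
  have hdiff : lam ^ 2 - (|t| * q) ^ 2 = f ⬝ᵥ A *ᵥ (x + t • a) := by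
    rw [← hsa, Real.sq_sqrt (qform_nonneg hApd _), ← hx, qform_sub_qform hA]
    congr 1
    rw [hxf, add_sub_cancel_left]
  have hsum : 0 < lam + |t| * q := by positivity
  have hclose : |lam - |t| * q| ≤ 3 * M ^ 3 * ρ := by
    have hw : ‖A *ᵥ (x + t • a)‖ ≤ M ^ 2 * (lam + |t| * q) :=
      calc ‖A *ᵥ (x + t • a)‖ ≤ M * ‖x + t • a‖ := hM₁ _
        _ ≤ M * (M * lam + M * (|t| * q)) := by
          gcongr
          refine (norm_add_le _ _).trans (add_le_add ?_ ?_)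
          · rw [← hsx]; exact hM₃ x
          · rw [← hsa]; exact hM₃ _
        _ = _ := by ring
    refine le_of_mul_le_mul_right ?_ hsum
    calc |lam - |t| * q| * (lam + |t| * q) = |lam ^ 2 - (|t| * q) ^ 2| := by
          rw [← abs_of_pos hsum, ← abs_mul]
          congr 1
          ring
      _ ≤ 3 * ‖f‖ * ‖A *ᵥ (x + t • a)‖ := by rw [hdiff]; exact abs_dotProduct_le _ _
      _ ≤ 3 * (M * ρ) * (M ^ 2 * (lam + |t| * q)) := by gcongr
      _ = _ := by ring
  have han : ‖a‖ ≤ M * q := hM₃ a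
  have hkey : ∀ r : ℝ, |r| = |(|t| - lam / q)| → ‖f + r • a‖ ≤ (M + 3 * M ^ 4) * ρ := by
    intro r hr
    calc ‖f + r • a‖ ≤ ‖f‖ + |r| * ‖a‖ := by
          refine (norm_add_le _ _).trans ?_
          rw [norm_smul, Real.norm_eq_abs]
      _ ≤ M * ρ + |r| * (M * q) := by gcongr
      _ = M * ρ + M * |lam - |t| * q| := by
          rw [hr, abs_sub_comm lam, ← abs_of_pos hqpos, mul_left_comm, ← abs_mul,
            abs_of_pos hqpos, sub_mul, div_mul_cancel₀ _ hqpos.ne']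
      _ ≤ M * ρ + M * (3 * M ^ 3 * ρ) := by gcongr
      _ = _ := by ring
  rcases le_total 0 t with ht0 | ht0
  · left
    have : x - (lam / q) • a = f + (t - lam / q) • a := by
      rw [hxf, sub_smul]; abel
    rw [this]
    exact hkey _ (by rw [abs_of_nonneg ht0])
  · right
    have : x - -((lam / q) • a) = f + (t + lam / q) • a := by
      rw [hxf, add_smul]; abel
    rw [this]
    refine hkey _ ?_
    rw [abs_of_nonpos ht0, ← abs_neg]
    congr 1
    ring

/-- The part of the level set `Q = λ²` on which the `i`-th coordinate of the normal dominates and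
has a given sign is the graph of a Lipschitz function of the other two coordinates. -/
theorem abs_sub_apply_le_of_dominant {A : Matrix (Fin 3) (Fin 3) ℝ} (hA : A.IsSymm)
    {x y : Fin 3 → ℝ} (hxy : Qform A x = Qform A y) {i : Fin 3}
    (hx : |(A *ᵥ x) i| = ‖A *ᵥ x‖) (hy : |(A *ᵥ y) i| = ‖A *ᵥ y‖) (hx0 : A *ᵥ x ≠ 0)
    (hsign : 0 ≤ (A *ᵥ x) i ↔ 0 ≤ (A *ᵥ y) i) :
    |x i - y i| ≤ |x (i + 1) - y (i + 1)| + |x (i + 2) - y (i + 2)| := by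
  set u := A *ᵥ x with hu
  set v := A *ᵥ y with hv
  have horth : (x - y) ⬝ᵥ (u + v) = 0 := by
    rw [hu, hv, ← mulVec_add, ← qform_sub_qform hA, hxy, sub_self]
  have hsum : |(u + v) i| = ‖u‖ + ‖v‖ := by
    rw [← hx, ← hy, Pi.add_apply]
    rcases le_or_gt 0 (u i) with h | h
    · have h' := hsign.1 h
      rw [abs_of_nonneg h, abs_of_nonneg h', abs_of_nonneg (add_nonneg h h')]
    · have h' := not_le.1 (mt hsign.2 h.not_ge)
      rw [abs_of_neg h, abs_of_neg h', abs_of_neg (add_neg h h'), neg_add]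
  have hle : ∀ j, |(u + v) j| ≤ |(u + v) i| := fun j => by
    rw [hsum]
    exact (norm_le_pi_norm (u + v) j).trans (norm_add_le u v)
  have hpos : 0 < |(u + v) i| := by
    rw [hsum]
    have := norm_pos_iff.2 hx0
    positivity
  have hexp : (x i - y i) * (u + v) i =
      -((x (i + 1) - y (i + 1)) * (u + v) (i + 1) + (x (i + 2) - y (i + 2)) * (u + v) (i + 2)) := by
    simp only [dotProduct, Fin.sum_univ_three, Pi.sub_apply] at horth
    fin_cases i <;> simp at horth ⊢ <;> linarith
  refine le_of_mul_le_mul_right ?_ hpos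
  rw [← abs_mul, hexp, abs_neg, add_mul]
  refine (abs_add_le _ _).trans (add_le_add ?_ ?_) <;> rw [abs_mul] <;>
    exact mul_le_mul_of_nonneg_left (hle _) (abs_nonneg _)

/-- A two-dimensional packing bound: separated points of the ellipsoid `Q = λ²` in a ball. -/
theorem finite_and_ncard_le_of_separated {A : Matrix (Fin 3) (Fin 3) ℝ} (hA : A.IsSymm)
    {lam R B : ℝ} (hlam : 0 < lam) (hR : 0 < R) (hB : 0 ≤ B) {X : Set (Fin 3 → ℝ)}
    (hQ : ∀ x ∈ X, Qform A x = lam ^ 2)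
    (hsep : ∀ x ∈ X, ∀ y ∈ X, x ≠ y → R ≤ enorm3 (x - y))
    (p : Fin 3 → ℝ) (hp : ∀ x ∈ X, ‖x - p‖ ≤ B) :
    X.Finite ∧ (X.ncard : ℝ) ≤ 6 * (8 * (B / R) + 3) ^ 2 := by
  classical
  choose idx hidx using fun x : Fin 3 → ℝ => exists_apply_eq_norm (A *ᵥ x)
  set r := R / 4 with hr
  have hrpos : 0 < r := by positivity
  let F : (Fin 3 → ℝ) → (Fin 3 × Bool) × ℤ × ℤ := fun x =>
    ((idx x, decide (0 ≤ (A *ᵥ x) (idx x))),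
      ⌊(x (idx x + 1) - p (idx x + 1)) / r⌋, ⌊(x (idx x + 2) - p (idx x + 2)) / r⌋)
  set n : ℤ := ⌈B / r⌉ with hn
  let T : Finset ((Fin 3 × Bool) × ℤ × ℤ) :=
    Finset.univ ×ˢ Finset.Icc (-n) n ×ˢ Finset.Icc (-n) n
  have hfloor : ∀ x ∈ X, ∀ j, ⌊(x j - p j) / r⌋ ∈ Finset.Icc (-n) n := by
    intro x hx j
    have h1 : |x j - p j| ≤ B := (norm_le_pi_norm (x - p) j).trans (hp x hx)
    rw [abs_le] at h1
    have h2 := Int.le_ceil (B / r)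
    rw [Finset.mem_Icc]
    constructor
    · rw [Int.le_floor, Int.cast_neg, le_div_iff₀ hrpos]
      rw [div_le_iff₀ hrpos] at h2
      linarith [h1.1]
    · have h3 := Int.floor_le ((x j - p j) / r)
      have h4 : (x j - p j) / r ≤ B / r := by gcongr; exact h1.2
      exact_mod_cast (h3.trans h4).trans h2
  have hmaps : ∀ x ∈ X, F x ∈ (T : Set ((Fin 3 × Bool) × ℤ × ℤ)) := by
    intro x hx
    simp only [T, F, Finset.coe_product, Set.mem_prod, Finset.mem_coe]
    exact ⟨Finset.mem_univ _, hfloor x hx _, hfloor x hx _⟩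
  have hclose : ∀ x y : Fin 3 → ℝ, ∀ j, ⌊(x j - p j) / r⌋ = ⌊(y j - p j) / r⌋ →
      |x j - y j| < r := by
    intro x y j hxy
    have := Int.abs_sub_lt_one_of_floor_eq_floor hxy
    rwa [← sub_div, sub_sub_sub_cancel_right, abs_div, abs_of_pos hrpos, div_lt_one hrpos] at this
  have hinj : Set.InjOn F X := by
    intro x hx y hy hxy
    by_contra hne
    simp only [F, Prod.mk.injEq] at hxy
    obtain ⟨⟨h1, h2⟩, h3, h4⟩ := hxy
    rw [← h1] at h2 h3 h4
    have hx0 : A *ᵥ x ≠ 0 := by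
      intro h0
      have := hQ x hx
      rw [qform_eq_dotProduct, h0, dotProduct_zero] at this
      exact (pow_pos hlam 2).ne this
    have hd1 := hclose x y _ h3
    have hd2 := hclose x y _ h4
    have hd0 := abs_sub_apply_le_of_dominant hA ((hQ x hx).trans (hQ y hy).symm)
      (hidx x) (by rw [h1]; exact hidx y) hx0 (by simpa using h2)
    have hall : ‖x - y‖ < 2 * r := by
      refine (pi_norm_lt_iff (by positivity)).2 fun j => ?_
      rw [Real.norm_eq_abs, Pi.sub_apply]
      have hj : j = idx x ∨ j = idx x + 1 ∨ j = idx x + 2 := by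
        generalize idx x = i
        fin_cases i <;> fin_cases j <;> decide
      rcases hj with rfl | rfl | rfl <;> linarith
    have h5 := hsep x hx y hy hne
    have h6 := enorm3_le_two_mul_norm (x - y)
    linarith
  refine ⟨Set.Finite.of_injOn hmaps hinj T.finite_toSet, ?_⟩
  have hcard := Set.ncard_le_ncard_of_injOn F hmaps hinj T.finite_toSet
  rw [Set.ncard_coe_finset] at hcard
  have hn0 : 0 ≤ n := Int.ceil_nonneg (by positivity)
  have hT : (T.card : ℝ) = 6 * (2 * (n : ℝ) + 1) ^ 2 := by
    have hI : ((Finset.Icc (-n) n).card : ℝ) = 2 * (n : ℝ) + 1 := by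
      rw [Int.card_Icc]
      have : (((n + 1 - -n).toNat : ℤ) : ℝ) = ((n + 1 - -n : ℤ) : ℝ) := by
        rw [Int.toNat_of_nonneg (by omega)]
      rw [Int.cast_natCast] at this
      rw [this]
      push_cast
      ring
    simp only [T, Finset.card_product, Finset.card_univ, Fintype.card_prod, Fintype.card_fin,
      Fintype.card_bool, Nat.cast_mul, hI]
    push_cast
    ring
  have hnB : 2 * (n : ℝ) + 1 ≤ 8 * (B / R) + 3 := by
    have h1 := Int.ceil_lt_add_one (B / r)
    have h2 : B / r = 4 * (B / R) := by rw [hr]; field_simp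
    rw [← hn, h2] at h1
    linarith
  have hn0' : (0 : ℝ) ≤ n := by exact_mod_cast hn0
  calc (X.ncard : ℝ) ≤ T.card := by exact_mod_cast hcard
    _ = 6 * (2 * (n : ℝ) + 1) ^ 2 := hT
    _ ≤ _ := by gcongr

theorem norm_intCast3_le_iff {h : Fin 3 → ℤ} {n : ℕ} :
    ‖intCast3 h‖ ≤ n ↔ h ∈ Finset.Icc (fun _ : Fin 3 => -(n : ℤ)) (fun _ => (n : ℤ)) := by
  rw [pi_norm_le_iff_of_nonneg n.cast_nonneg, Finset.mem_Icc, Pi.le_def, Pi.le_def, ← forall_and]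
  refine forall_congr' fun i => ?_
  rw [intCast3, Real.norm_eq_abs, abs_le]
  norm_cast

/-- The sum of `‖h‖⁻²` over the nonzero lattice points of a cube grows linearly. -/
theorem sum_inv_norm_sq_le (n : ℕ) :
    ∑ h ∈ (Finset.Icc (fun _ : Fin 3 => -(n : ℤ)) (fun _ => (n : ℤ))).erase 0,
      (‖intCast3 h‖ ^ 2)⁻¹ ≤ 26 * n := by
  classical
  set cube : ℕ → Finset (Fin 3 → ℤ) := fun n =>
    Finset.Icc (fun _ : Fin 3 => -(n : ℤ)) (fun _ => (n : ℤ)) with hcube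
  have hcard : ∀ n, (cube n).card = (2 * n + 1) ^ 3 := fun n => by
    simp only [hcube, Pi.card_Icc, Int.card_Icc, Finset.prod_const, Finset.card_univ,
      Fintype.card_fin]
    congr 1
    omega
  change ∑ h ∈ (cube n).erase 0, (‖intCast3 h‖ ^ 2)⁻¹ ≤ 26 * n
  induction n with
  | zero =>
    have : (cube 0).erase 0 = ∅ := by
      ext h
      simp only [hcube, Finset.mem_erase, Finset.mem_Icc, Finset.notMem_empty, iff_false, not_and]
      intro h0 hle hge
      exact h0 (funext fun i => le_antisymm (by simpa using hge i) (by simpa using hle i))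
    simp [this]
  | succ n ih =>
    have hmono : cube n ⊆ cube (n + 1) := fun h hh =>
      norm_intCast3_le_iff.1 ((norm_intCast3_le_iff.2 hh).trans (by push_cast; linarith))
    have hsub : (cube (n + 1)).erase 0 ⊆ (cube n).erase 0 ∪ (cube (n + 1) \ cube n) := by
      intro h
      simp only [Finset.mem_erase, Finset.mem_union, Finset.mem_sdiff]
      tauto
    have hshell : ∀ h ∈ cube (n + 1) \ cube n,
        (‖intCast3 h‖ ^ 2)⁻¹ ≤ (((n : ℝ) + 1) ^ 2)⁻¹ := by
      intro h hh
      have hnot := (Finset.mem_sdiff.1 hh).2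
      have hge : (n : ℝ) + 1 ≤ ‖intCast3 h‖ := by
        obtain ⟨i, hi⟩ := exists_apply_eq_norm (intCast3 h)
        have hlt : (n : ℝ) < ‖intCast3 h‖ := not_le.1 fun hle => hnot (norm_intCast3_le_iff.1 hle)
        rw [← hi, intCast3] at hlt ⊢
        have : (n : ℤ) < |h i| := by exact_mod_cast hlt
        exact_mod_cast this
      gcongr
    have hshellcard : ((cube (n + 1) \ cube n).card : ℝ) ≤ 26 * ((n : ℝ) + 1) ^ 2 := by
      rw [Finset.card_sdiff_of_subset hmono, Nat.cast_sub (Finset.card_le_card hmono), hcard, hcard]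
      push_cast
      nlinarith [(n.cast_nonneg : (0 : ℝ) ≤ n)]
    calc ∑ h ∈ (cube (n + 1)).erase 0, (‖intCast3 h‖ ^ 2)⁻¹
        ≤ ∑ h ∈ (cube n).erase 0 ∪ (cube (n + 1) \ cube n), (‖intCast3 h‖ ^ 2)⁻¹ :=
          Finset.sum_le_sum_of_subset_of_nonneg hsub fun _ _ _ => by positivity
      _ ≤ ∑ h ∈ (cube n).erase 0, (‖intCast3 h‖ ^ 2)⁻¹ +
            ∑ h ∈ cube (n + 1) \ cube n, (‖intCast3 h‖ ^ 2)⁻¹ := by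
          rw [← Finset.sum_union_inter]
          exact le_add_of_nonneg_right (Finset.sum_nonneg fun _ _ => by positivity)
      _ ≤ 26 * n + ∑ _h ∈ cube (n + 1) \ cube n, (((n : ℝ) + 1) ^ 2)⁻¹ :=
          add_le_add ih (Finset.sum_le_sum hshell)
      _ ≤ 26 * n + 26 * ((n : ℝ) + 1) ^ 2 * (((n : ℝ) + 1) ^ 2)⁻¹ := by
          rw [Finset.sum_const, nsmul_eq_mul]
          gcongr
      _ = 26 * ((n + 1 : ℕ) : ℝ) := by
          push_cast
          field_simp

/-- The lattice points of a rank-two cap with many points lie in planes with a short normal `h`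
whose direction is close to the normal direction of the ellipsoid at the center of the cap. -/
theorem exists_normal_of_rank_two_cap {A : Matrix (Fin 3) (Fin 3) ℝ} (hA : A.IsSymm)
    (hApd : A.PosDef) {M : ℝ} (hM : 0 ≤ M) (hM₁ : ∀ z, ‖A *ᵥ z‖ ≤ M * ‖z‖)
    {lam δ : ℝ} (hlam : 1 < lam) (hδ0 : 0 < δ) (hδ : δ < 1) {x₀ : Fin 3 → ℝ}
    (hx₀ : Qform A x₀ = lam ^ 2) (hrank : Module.finrank ℤ (capSpan A lam δ x₀) = 2)
    (hN2 : 2 ≤ Ncap A lam δ x₀) {K : ℝ} (hK : lam * δ ≤ K * Ncap A lam δ x₀) :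
    ∃ h : Fin 3 → ℤ, h ≠ 0 ∧ ‖intCast3 h‖ ≤ 64 * K ∧
      ‖intCast3 h ⨯₃ (A *ᵥ x₀)‖ ≤ 96 * (1 + M) * √(lam * δ) * K := by
  set R := √(lam * δ) with hR
  have hR2 : R ^ 2 = lam * δ := Real.sq_sqrt (by positivity)
  have hR0 : 0 ≤ R := Real.sqrt_nonneg _
  have hfin : (capLattice A lam δ x₀).Finite := Set.finite_of_ncard_ne_zero (by
    rw [Ncap] at hN2; omega)
  have hcard : hfin.toFinset.card = Ncap A lam δ x₀ :=
    (Set.ncard_eq_toFinset_card _ hfin).symm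
  have hspan : ∀ y ∈ hfin.toFinset, ∀ z ∈ hfin.toFinset, y - z ∈ capSpan A lam δ x₀ :=
    fun y hy z hz => Submodule.subset_span
      ⟨y, hfin.mem_toFinset.1 hy, z, hfin.mem_toFinset.1 hz, rfl⟩
  obtain ⟨p, hp, q, hq, u, hu, c, h, hh, hc, hcN⟩ :=
    exists_cross_eq_large_smul (S := hfin.toFinset) (hcard ▸ hN2)
      (fun p hp q hq r hr t ht => dotProduct_cross_eq_zero_of_finrank_eq_two hrank
        (hspan q hq p hp) (hspan r hr p hp) (hspan t ht p hp))
      (fun p d => by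
        obtain ⟨x, hx, hxk⟩ := exists_sub_ne_smul_of_finrank_eq_two hrank p d
        exact ⟨x, hfin.mem_toFinset.2 hx, hxk⟩)
  rw [hcard] at hcN
  have hcN' : (Ncap A lam δ x₀ : ℝ) ≤ 8 * |(c : ℝ)| := by exact_mod_cast hcN
  have hNpos : (0 : ℝ) < Ncap A lam δ x₀ := by
    have : 0 < Ncap A lam δ x₀ := by omega
    exact_mod_cast this
  have hcpos : 0 < |(c : ℝ)| := by linarith
  have hK0 : 0 ≤ K := by
    refine nonneg_of_mul_nonneg_left (b := (Ncap A lam δ x₀ : ℝ)) ?_ hNpos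
    exact le_trans (by positivity) hK
  have hKc : lam * δ ≤ 8 * K * |(c : ℝ)| :=
    hK.trans (by nlinarith [mul_le_mul_of_nonneg_left hcN' hK0])
  have hnear : ∀ k ∈ hfin.toFinset, ‖intCast3 k - x₀‖ ≤ R ∧
      |(intCast3 k - x₀) ⬝ᵥ A *ᵥ x₀| ≤ (3 + 3 * M) / 2 * (lam * δ) := by
    intro k hk
    obtain ⟨hk1, hk2⟩ := hfin.mem_toFinset.1 hk
    have hy : ‖intCast3 k - x₀‖ ≤ R := (norm_le_enorm3 _).trans hk2.le
    refine ⟨hy, ?_⟩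
    set y := intCast3 k - x₀ with hy_def
    have hexp := qform_add hA x₀ y
    rw [hy_def, add_sub_cancel, ← hy_def, hx₀] at hexp
    have hQy : Qform A y ≤ 3 * M * (lam * δ) := by
      rw [qform_eq_dotProduct]
      calc y ⬝ᵥ A *ᵥ y ≤ 3 * ‖y‖ * ‖A *ᵥ y‖ := (le_abs_self _).trans (abs_dotProduct_le _ _)
        _ ≤ 3 * R * (M * R) := by
          gcongr
          exact (hM₁ y).trans (by gcongr)
        _ = 3 * M * (lam * δ) := by rw [← hR2]; ring
    have hQy0 := qform_nonneg hApd y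
    have hQk := Real.sq_sqrt (qform_nonneg hApd (intCast3 k))
    have hsk := Real.sqrt_nonneg (Qform A (intCast3 k))
    rw [abs_lt] at hk1
    have hδlam : δ * δ ≤ lam * δ := by nlinarith
    rw [abs_le]
    constructor <;> nlinarith
  have hdiff : ∀ k ∈ hfin.toFinset, ∀ l ∈ hfin.toFinset,
      ‖intCast3 k - intCast3 l‖ ≤ 2 * R ∧
      |(intCast3 k - intCast3 l) ⬝ᵥ A *ᵥ x₀| ≤ (3 + 3 * M) * (lam * δ) := by
    intro k hk l hl
    obtain ⟨h1, h2⟩ := hnear k hk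
    obtain ⟨h3, h4⟩ := hnear l hl
    rw [← sub_sub_sub_cancel_right (intCast3 k) (intCast3 l) x₀]
    constructor
    · exact (norm_sub_le _ _).trans (by linarith)
    · rw [sub_dotProduct]
      exact (abs_sub _ _).trans (by linarith)
  obtain ⟨ha, hau⟩ := hdiff q hq p hp
  obtain ⟨hb, hbu⟩ := hdiff u hu p hp
  set a := intCast3 q - intCast3 p with ha_def
  set b := intCast3 u - intCast3 p with hb_def
  have hcast : a ⨯₃ b = (c : ℝ) • intCast3 h := by
    funext i
    have hi := congrArg (Int.cast : ℤ → ℝ) (congrFun hc i)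
    fin_cases i <;> simpa [cross_apply, ha_def, hb_def, intCast3] using hi
  refine ⟨h, hh, ?_, ?_⟩
  · refine le_of_mul_le_mul_left ?_ hcpos
    rw [← Real.norm_eq_abs, ← norm_smul, ← hcast]
    refine (pi_norm_le_iff_of_nonneg (by positivity)).2 fun i => ?_
    have hprod : ∀ j k, |a j * b k| ≤ 2 * R * (2 * R) := fun j k => by
      rw [abs_mul]
      exact mul_le_mul ((norm_le_pi_norm a j).trans ha) ((norm_le_pi_norm b k).trans hb)
        (abs_nonneg _) (by positivity)
    have hbound : ∀ j k, |a j * b k - a k * b j| ≤ |(c : ℝ)| * (64 * K) := fun j k =>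
      calc |a j * b k - a k * b j| ≤ |a j * b k| + |a k * b j| := abs_sub _ _
        _ ≤ 2 * R * (2 * R) + 2 * R * (2 * R) := add_le_add (hprod _ _) (hprod _ _)
        _ = 8 * R ^ 2 := by ring
        _ ≤ 8 * (8 * K * |(c : ℝ)|) := by rw [hR2]; gcongr
        _ = _ := by ring
    rw [Real.norm_eq_abs (c : ℝ), cross_apply]
    fin_cases i
    · exact hbound 1 2
    · exact hbound 2 0
    · exact hbound 0 1
  · refine le_of_mul_le_mul_left ?_ hcpos
    rw [← Real.norm_eq_abs, ← norm_smul, ← LinearMap.smul_apply, ← map_smul, ← hcast,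
      cross_cross_eq_smul_sub_smul, Real.norm_eq_abs]
    calc ‖(a ⬝ᵥ A *ᵥ x₀) • b - (b ⬝ᵥ A *ᵥ x₀) • a‖
        ≤ |a ⬝ᵥ A *ᵥ x₀| * ‖b‖ + |b ⬝ᵥ A *ᵥ x₀| * ‖a‖ := by
          refine (norm_sub_le _ _).trans ?_
          rw [norm_smul, norm_smul, Real.norm_eq_abs, Real.norm_eq_abs]
      _ ≤ (3 + 3 * M) * (lam * δ) * (2 * R) + (3 + 3 * M) * (lam * δ) * (2 * R) := by gcongr
      _ = 12 * (1 + M) * R * (lam * δ) := by ring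
      _ ≤ 12 * (1 + M) * R * (8 * K * |(c : ℝ)|) := by gcongr
      _ = _ := by ring

theorem exists_uniform_bounds {A : Matrix (Fin 3) (Fin 3) ℝ} (hA : A.PosDef) :
    ∃ M : ℝ, 0 ≤ M ∧ (∀ z, ‖A *ᵥ z‖ ≤ M * ‖z‖) ∧ (∀ z, ‖A⁻¹ *ᵥ z‖ ≤ M * ‖z‖) ∧
      ∀ z, ‖z‖ ≤ M * √(Qform A z) := by
  obtain ⟨M₁, h₁⟩ := exists_norm_mulVec_le A
  obtain ⟨M₂, h₂⟩ := exists_norm_mulVec_le A⁻¹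
  obtain ⟨M₃, h₃⟩ := exists_norm_le_mul_sqrt_qform hA
  have hle₁ : M₁ ≤ |M₁| + |M₂| + |M₃| := by
    linarith [le_abs_self M₁, abs_nonneg M₂, abs_nonneg M₃]
  have hle₂ : M₂ ≤ |M₁| + |M₂| + |M₃| := by
    linarith [le_abs_self M₂, abs_nonneg M₁, abs_nonneg M₃]
  have hle₃ : M₃ ≤ |M₁| + |M₂| + |M₃| := by
    linarith [le_abs_self M₃, abs_nonneg M₁, abs_nonneg M₂]
  exact ⟨|M₁| + |M₂| + |M₃|, by positivity, fun z => (h₁ z).trans (by gcongr),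
    fun z => (h₂ z).trans (by gcongr), fun z => (h₃ z).trans (by gcongr)⟩

theorem statement14 (A : Matrix (Fin 3) (Fin 3) ℝ) (hA : A.IsSymm) (hApd : A.PosDef) :
    ∃ C : ℝ, 0 < C ∧
      ∀ lam δ : ℝ, 1 < lam → lam⁻¹ ≤ δ → δ < 1 →
        ∀ centers : Set (Fin 3 → ℝ),
          (∀ x ∈ centers, Qform A x = lam ^ 2) →
          (∀ x ∈ centers, ∀ y ∈ centers, x ≠ y → Real.sqrt (lam * δ) ≤ enorm3 (x - y)) →
          ∀ s : ℕ, 1 ≤ s →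
            (({x₀ ∈ centers |
                Module.finrank ℤ ↥(capSpan A lam δ x₀) = 2 ∧
                2 ^ s ≤ Ncap A lam δ x₀ ∧ Ncap A lam δ x₀ < 2 ^ (s + 1)}).ncard : ℝ)
              ≤ C * ((2:ℝ) ^ (-(s:ℝ)) * (lam * δ)) ^ 3 := by
  obtain ⟨M, hM, hM₁, hM₂, hM₃⟩ := exists_uniform_bounds hApd
  set C₁ := 96 * (1 + M) with hC₁
  set C₂ := M + 3 * M ^ 4 with hC₂
  set C₃ := 8 * C₂ * C₁ + 3 * C₁ with hC₃
  have hC₁pos : 0 < C₁ := by positivity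
  have hC₂nn : 0 ≤ C₂ := by positivity
  have hC₃pos : 0 < C₃ := by positivity
  refine ⟨312 * C₃ ^ 2 * C₁, by positivity, ?_⟩
  intro lam δ hlam hδlam hδ centers hQ hsep s hs
  have hlam0 : 0 < lam := by linarith
  have hδ0 : 0 < δ := (inv_pos.2 hlam0).trans_le hδlam
  set R := √(lam * δ) with hR
  have hR0 : 0 < R := Real.sqrt_pos.2 (by positivity)
  set K := (2:ℝ) ^ (-(s:ℝ)) * (lam * δ) with hK
  have hK0 : 0 < K := by positivity
  have hKs : lam * δ = K * 2 ^ s := by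
    rw [hK, Real.rpow_neg two_pos.le, Real.rpow_natCast]
    field_simp
  set X := {x₀ ∈ centers |
    Module.finrank ℤ ↥(capSpan A lam δ x₀) = 2 ∧
    2 ^ s ≤ Ncap A lam δ x₀ ∧ Ncap A lam δ x₀ < 2 ^ (s + 1)} with hX
  let Y : (Fin 3 → ℤ) → Set (Fin 3 → ℝ) := fun h =>
    {x ∈ X | ‖intCast3 h ⨯₃ (A *ᵥ x)‖ ≤ C₁ * R * K}
  set n := ⌊C₁ * K⌋₊ with hn
  have hnK : (n : ℝ) ≤ C₁ * K := Nat.floor_le (by positivity)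
  let H := (Finset.Icc (fun _ : Fin 3 => -(n : ℤ)) (fun _ => (n : ℤ))).erase 0
  have hcover : X ⊆ ⋃ h ∈ H, Y h := by
    intro x hx
    have ⟨hxc, hrank, hN, _⟩ := hx
    have hN2 : 2 ≤ Ncap A lam δ x := (Nat.le_self_pow (by omega) 2).trans hN
    have hKN : lam * δ ≤ K * Ncap A lam δ x := by
      rw [hKs]
      gcongr
      exact_mod_cast hN
    obtain ⟨h, hh0, hhK, hhx⟩ := exists_normal_of_rank_two_cap hA hApd hM hM₁ hlam hδ0 hδ
      (hQ x hxc) hrank hN2 hKN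
    refine Set.mem_biUnion (x := h) ?_ ⟨hx, hhx⟩
    refine Finset.mem_coe.2 (Finset.mem_erase.2 ⟨hh0, norm_intCast3_le_iff.1 ?_⟩)
    refine (pi_norm_le_iff_of_nonneg n.cast_nonneg).2 fun i => ?_
    have h1 : ‖intCast3 h i‖ ≤ C₁ * K := (norm_le_pi_norm _ i).trans (hhK.trans (by
      rw [hC₁]; gcongr; linarith))
    have h2 : ‖intCast3 h i‖ = ((h i).natAbs : ℝ) := by
      rw [intCast3, Real.norm_eq_abs, Nat.cast_natAbs, Int.cast_abs]
    rw [h2] at h1 ⊢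
    exact_mod_cast Nat.le_floor h1
  have hY : ∀ h ∈ H, (Y h).Finite ∧
      ((Y h).ncard : ℝ) ≤ 12 * C₃ ^ 2 * K ^ 2 * (‖intCast3 h‖ ^ 2)⁻¹ := by
    intro h hhH
    obtain ⟨hh0, hhn⟩ := Finset.mem_erase.1 hhH
    have hcast0 : intCast3 h ≠ 0 := fun h0 => hh0 (funext fun i => by
      have := congrFun h0 i
      simpa [intCast3] using this)
    have hnorm : 0 < ‖intCast3 h‖ := norm_pos_iff.2 hcast0
    have hnormK : ‖intCast3 h‖ ≤ C₁ * K := (norm_intCast3_le_iff.2 hhn).trans hnK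
    obtain ⟨p, hp⟩ := exists_norm_sub_le_of_norm_cross_le hA hApd hM hM₁ hM₂ hM₃ hcast0 hlam0
    set ρ := C₁ * R * K / ‖intCast3 h‖ with hρ
    have hB : 0 ≤ C₂ * ρ := by positivity
    have hpack : ∀ p' : Fin 3 → ℝ, {x ∈ X | ‖x - p'‖ ≤ C₂ * ρ}.Finite ∧
        ({x ∈ X | ‖x - p'‖ ≤ C₂ * ρ}.ncard : ℝ) ≤ 6 * (8 * (C₂ * ρ / R) + 3) ^ 2 := fun p' =>
      finite_and_ncard_le_of_separated hA hlam0 hR0 hB (fun x hx => hQ x hx.1.1)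
        (fun x hx y hy => hsep x hx.1.1 y hy.1.1) p' fun x hx => hx.2
    have hsub : Y h ⊆ {x ∈ X | ‖x - p‖ ≤ C₂ * ρ} ∪ {x ∈ X | ‖x - -p‖ ≤ C₂ * ρ} := by
      intro x hx
      have hc : ‖intCast3 h ⨯₃ (A *ᵥ x)‖ ≤ ρ * ‖intCast3 h‖ := by
        rw [hρ, div_mul_cancel₀ _ hnorm.ne']
        exact hx.2
      exact (hp x ρ (hQ x hx.1.1) hc).imp (fun h1 => ⟨hx.1, h1⟩) fun h1 => ⟨hx.1, h1⟩
    have hfin := (hpack p).1.union (hpack (-p)).1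
    refine ⟨hfin.subset hsub, ?_⟩
    have hle : 8 * (C₂ * ρ / R) + 3 ≤ C₃ * K / ‖intCast3 h‖ := by
      rw [le_div_iff₀ hnorm, hρ, hC₃]
      have : (8 * (C₂ * (C₁ * R * K / ‖intCast3 h‖) / R) + 3) * ‖intCast3 h‖ =
          8 * C₂ * C₁ * K + 3 * ‖intCast3 h‖ := by field_simp
      rw [this]
      linarith
    have hnn : 0 ≤ 8 * (C₂ * ρ / R) + 3 := by positivity
    calc ((Y h).ncard : ℝ)
        ≤ ({x ∈ X | ‖x - p‖ ≤ C₂ * ρ}.ncard : ℝ) + ({x ∈ X | ‖x - -p‖ ≤ C₂ * ρ}.ncard : ℝ) := by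
          exact_mod_cast (Set.ncard_le_ncard hsub hfin).trans (Set.ncard_union_le _ _)
      _ ≤ 6 * (8 * (C₂ * ρ / R) + 3) ^ 2 + 6 * (8 * (C₂ * ρ / R) + 3) ^ 2 :=
          add_le_add (hpack p).2 (hpack (-p)).2
      _ = 12 * (8 * (C₂ * ρ / R) + 3) ^ 2 := by ring
      _ ≤ 12 * (C₃ * K / ‖intCast3 h‖) ^ 2 := by gcongr
      _ = _ := by field_simp
  have hfin : (⋃ h ∈ H, Y h).Finite := H.finite_toSet.biUnion fun h hh => (hY h hh).1
  calc (X.ncard : ℝ) ≤ ∑ h ∈ H, ((Y h).ncard : ℝ) := by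
        exact_mod_cast (Set.ncard_le_ncard hcover hfin).trans (Finset.set_ncard_biUnion_le H Y)
    _ ≤ ∑ h ∈ H, 12 * C₃ ^ 2 * K ^ 2 * (‖intCast3 h‖ ^ 2)⁻¹ :=
        Finset.sum_le_sum fun h hh => (hY h hh).2
    _ = 12 * C₃ ^ 2 * K ^ 2 * ∑ h ∈ H, (‖intCast3 h‖ ^ 2)⁻¹ := by rw [Finset.mul_sum]
    _ ≤ 12 * C₃ ^ 2 * K ^ 2 * (26 * (C₁ * K)) := by
        gcongr
        exact (sum_inv_norm_sq_le n).trans (by gcongr)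
    _ = 312 * C₃ ^ 2 * C₁ * K ^ 3 := by ring
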